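/- There exists α_0 > 0 (depending only on β, b, σ) such that for every α ∈ (0, α_0) there exists a_0 > 1 with the property: for all a ≥ a_0 and all integers q ≥ 1, δ_{q−1}^{1/2} λ_{q−1} ℓ_q^{2−2α} ≤ ε_q τ_q δ_{q+1}. -/

import Mathlib

open Filter Topology

/-- `λ_q := ⌈a^(b^q)⌉`, as a real number. -/
noncomputable def lam (a b : ℝ) (q : ℕ) : ℝ := (⌈a ^ (b ^ q)⌉₊ : ℝ)

/-- `δ_q := λ_q^(-2β)`. -/
noncomputable def del (a b β : ℝ) (q : ℕ) : ℝ := lam a b q ^ (-(2 * β))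

/-- `ε_q := λ_q^(-σ)`. -/
noncomputable def eps (a b σ : ℝ) (q : ℕ) : ℝ := lam a b q ^ (-σ)

/-- `τ_q := δ_q^(-1/2) λ_q^(-1-3α)`. -/
noncomputable def tau (a b β α : ℝ) (q : ℕ) : ℝ :=
  del a b β q ^ (-(1/2 : ℝ)) * lam a b q ^ (-(1 + 3 * α))

/-- `ℓ_q := δ_{q+1}^(1/2) δ_q^(-1/2) λ_q^(-(1+σ/2+3α/2))`. -/
noncomputable def ell (a b β σ α : ℝ) (q : ℕ) : ℝ :=
  del a b β (q + 1) ^ ((1/2 : ℝ)) * del a b β q ^ (-(1/2 : ℝ)) *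
    lam a b q ^ (-(1 + σ/2 + 3 * α / 2))

theorem one_le_rpow_pow {a b : ℝ} (ha : 1 < a) (hb : 0 < b) (q : ℕ) : 1 ≤ a ^ (b ^ q) :=
  Real.one_le_rpow ha.le (pow_pos hb q).le

theorem lam_pos {a b : ℝ} (ha : 1 < a) (hb : 0 < b) (q : ℕ) : 0 < lam a b q :=
  (zero_lt_one.trans_le (one_le_rpow_pow ha hb q)).trans_le (Nat.le_ceil _)

theorem pow_mul_log_le_log_lam {a b : ℝ} (ha : 1 < a) (hb : 0 < b) (q : ℕ) :
    b ^ q * Real.log a ≤ Real.log (lam a b q) := by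
  rw [← Real.log_rpow (by linarith)]
  exact Real.log_le_log (by linarith [one_le_rpow_pow ha hb q]) (Nat.le_ceil _)

theorem log_lam_le {a b : ℝ} (ha : 1 < a) (hb : 0 < b) (q : ℕ) :
    Real.log (lam a b q) ≤ b ^ q * Real.log a + 1 := by
  have h1 := one_le_rpow_pow ha hb q
  have h2 : lam a b q ≤ 2 * a ^ (b ^ q) := by
    have := Nat.ceil_lt_add_one (zero_le_one.trans h1)
    unfold lam
    linarith
  have h3 := Real.log_le_log (lam_pos ha hb q) h2
  rw [Real.log_mul two_ne_zero (by linarith), Real.log_rpow (by linarith)] at h3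
  linarith [Real.log_two_lt_d9]

theorem log_del {a b : ℝ} (ha : 1 < a) (hb : 0 < b) (β : ℝ) (q : ℕ) :
    0 < del a b β q ∧ Real.log (del a b β q) = -(2 * β) * Real.log (lam a b q) :=
  ⟨Real.rpow_pos_of_pos (lam_pos ha hb q) _, Real.log_rpow (lam_pos ha hb q) _⟩

theorem log_ell {a b : ℝ} (ha : 1 < a) (hb : 0 < b) (β σ α : ℝ) (q : ℕ) :
    0 < ell a b β σ α q ∧ Real.log (ell a b β σ α q) =
      -β * Real.log (lam a b (q + 1)) - (1 - β + σ / 2 + 3 * α / 2) * Real.log (lam a b q) := by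
  have hl := lam_pos ha hb q
  obtain ⟨h1, e1⟩ := log_del ha hb β q
  obtain ⟨h2, e2⟩ := log_del ha hb β (q + 1)
  unfold ell
  refine ⟨by positivity, ?_⟩
  rw [Real.log_mul (by positivity) (by positivity), Real.log_mul (by positivity) (by positivity),
    Real.log_rpow h1, Real.log_rpow h2, Real.log_rpow hl, e1, e2]
  ring

theorem log_tau {a b : ℝ} (ha : 1 < a) (hb : 0 < b) (β α : ℝ) (q : ℕ) :
    0 < tau a b β α q ∧
      Real.log (tau a b β α q) = (β - 1 - 3 * α) * Real.log (lam a b q) := by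
  have hl := lam_pos ha hb q
  obtain ⟨h1, e1⟩ := log_del ha hb β q
  unfold tau
  refine ⟨by positivity, ?_⟩
  rw [Real.log_mul (by positivity) (by positivity), Real.log_rpow h1, Real.log_rpow hl, e1]
  ring

theorem log_eps {a b : ℝ} (ha : 1 < a) (hb : 0 < b) (σ : ℝ) (q : ℕ) :
    0 < eps a b σ q ∧ Real.log (eps a b σ q) = -σ * Real.log (lam a b q) :=
  ⟨Real.rpow_pos_of_pos (lam_pos ha hb q) _, Real.log_rpow (lam_pos ha hb q) _⟩

/-- for sufficiently small `α` and sufficiently large `a`, one has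
`δ_{q-1}^{1/2} λ_{q-1} ℓ_q^{2-2α} ≤ ε_q τ_q δ_{q+1}` for all `q ≥ 1`. -/
theorem stmt2 (β b σ : ℝ) (hβ : 0 < β) (hβ' : β < 1/3) (hb : 1 < b) (hσ : 0 < σ) :
    ∃ α0 : ℝ, 0 < α0 ∧ ∀ α : ℝ, 0 < α → α < α0 →
      ∃ a0 : ℝ, 1 < a0 ∧ ∀ a : ℝ, a0 ≤ a → ∀ q : ℕ, 1 ≤ q →
        del a b β (q - 1) ^ ((1:ℝ)/2) * lam a b (q - 1) *
            ell a b β σ α q ^ ((2:ℝ) - 2 * α)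
          ≤ eps a b σ q * tau a b β α q * del a b β (q + 1) := by
  have hb0 : 0 < b := by linarith
  have hm : 0 < (1 - β) * (1 - 1 / b) := by
    have : 1 / b < 1 := by rwa [div_lt_one hb0]
    exact mul_pos (by linarith) (by linarith)
  have hK : 0 < (1 - β + σ / 2 + 3 / 2) + β * b := by
    have := mul_pos hβ hb0
    linarith
  refine ⟨min 1 ((1 - β) * (1 - 1 / b) / (4 * ((1 - β + σ / 2 + 3 / 2) + β * b))),
    lt_min one_pos (by positivity), fun α hα hα0 => ?_⟩
  obtain ⟨hα1, hα2⟩ := lt_min_iff.1 hα0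
  rw [lt_div_iff₀ (by positivity)] at hα2
  refine ⟨Real.exp (4 / ((1 - β) * (1 - 1 / b))), Real.one_lt_exp_iff.2 (by positivity),
    fun a ha q hq => ?_⟩
  have ha1 : 1 < a := (Real.one_lt_exp_iff.2 (by positivity)).trans_le ha
  have hA : 4 / ((1 - β) * (1 - 1 / b)) ≤ Real.log a :=
    (Real.le_log_iff_exp_le (by linarith)).2 ha
  rw [div_le_iff₀ hm] at hA
  obtain ⟨p, rfl⟩ : ∃ p, q = p + 1 := ⟨q - 1, by omega⟩
  rw [Nat.add_sub_cancel]
  have hl := lam_pos ha1 hb0 p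
  obtain ⟨hd, ed⟩ := log_del ha1 hb0 β p
  obtain ⟨hd', ed'⟩ := log_del ha1 hb0 β (p + 1 + 1)
  obtain ⟨he, ee⟩ := log_ell ha1 hb0 β σ α (p + 1)
  obtain ⟨hs, es⟩ := log_eps ha1 hb0 σ (p + 1)
  obtain ⟨ht, et⟩ := log_tau ha1 hb0 β α (p + 1)
  rw [← Real.log_le_log_iff (by positivity) (by positivity),
    Real.log_mul (by positivity) (by positivity), Real.log_mul (by positivity) (by positivity),
    Real.log_mul (by positivity) (by positivity), Real.log_mul (by positivity) (by positivity),
    Real.log_rpow hd, Real.log_rpow he, ed, ed', ee, es, et]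
  have hx := log_lam_le ha1 hb0 p
  have hy := pow_mul_log_le_log_lam ha1 hb0 (p + 1)
  have hz := log_lam_le ha1 hb0 (p + 1 + 1)
  have hpow : Real.log a ≤ b ^ (p + 1) * Real.log a :=
    le_mul_of_one_le_left (Real.log_pos ha1).le (one_le_pow₀ hb.le)
  have ex : b ^ p * Real.log a = 1 / b * (b ^ (p + 1) * Real.log a) := by
    field_simp
    ring
  have ez : b ^ (p + 1 + 1) * Real.log a = b * (b ^ (p + 1) * Real.log a) := by ring
  rw [ex] at hx
  rw [ez] at hz
  generalize Real.log (lam a b p) = x at *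
  generalize Real.log (lam a b (p + 1)) = y at *
  generalize Real.log (lam a b (p + 1 + 1)) = z at *
  generalize b ^ (p + 1) * Real.log a = w at *
  have hw : 4 ≤ w * ((1 - β) * (1 - 1 / b)) :=
    hA.trans (mul_le_mul_of_nonneg_right hpow hm.le)
  have hw0 : 0 < w := (Real.log_pos ha1).trans_le hpow
  have ht0 : 0 < 1 / b := by positivity
  generalize 1 / b = t at *
  have hc : 2 * α * (1 - β + σ / 2 + 3 * α / 2 + β * b) ≤ (1 - β) * (1 - t) / 2 := by
    have := mul_nonneg hα.le (sub_nonneg.2 hα1.le)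
    linarith
  have hαβ : 0 < α * β := mul_pos hα hβ
  have hC : 0 ≤ 1 - β - 2 * α * (1 - β + σ / 2 + 3 * α / 2) := by
    have := mul_pos hαβ hb0
    have : (1 - β) * (1 - t) ≤ 1 - β := by
      have : 0 ≤ (1 - β) * t := mul_nonneg (by linarith) ht0.le
      linarith
    linarith
  have h1 := mul_nonneg hC (sub_nonneg.2 hy)
  have h2 := mul_le_mul_of_nonneg_left hz hαβ.le
  have h3 := mul_le_mul_of_nonneg_left hx (show 0 ≤ 1 - β by linarith)
  have h4 := mul_le_mul_of_nonneg_left hc hw0.le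
  have h5 : α * β ≤ β := mul_le_of_le_one_left hβ.le hα1.le
  linarith
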